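/- Let x̄ be an asymptotically stable equilibrium of the autonomous system ẋ = f(x, ū), with domain of attraction O. For each compact subset K ⊆ O and each ε > 0 there exist T₀ ≥ 0 and δ > 0 with the following property: for every input u defined on [0,∞) such that ‖u‖ < δ and every ξ ∈ K, the solution x(t) = φ(t, ξ, u) is defined for all t ≥ 0 and satisfies |x(t)| ≤ ε for all t ≥ T₀. -/

import Mathlib

open MeasureTheory Metric Set Filter Topology

/-- `x` is a (Carathéodory) solution of the control system `ẋ = f(x, u)` on the
time interval `I` (assumed to contain `0`), staying in the open state space `X`:
`x` is continuous on `I`, takes values in `X`, and satisfies the integral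
equation `x t = x 0 + ∫₀ᵗ f (x s) (u s) ds` on `I`. -/
def IsSolOn {n : ℕ} {U : Type*} [MetricSpace U]
    (X : Set (EuclideanSpace ℝ (Fin n)))
    (f : EuclideanSpace ℝ (Fin n) → U → EuclideanSpace ℝ (Fin n))
    (u : ℝ → U) (x : ℝ → EuclideanSpace ℝ (Fin n)) (I : Set ℝ) : Prop :=
  ContinuousOn x I ∧ (∀ t ∈ I, x t ∈ X) ∧
  (∀ t ∈ I, IntervalIntegrable (fun s => f (x s) (u s)) volume 0 t) ∧
  (∀ t ∈ I, x t = x 0 + ∫ s in (0:ℝ)..t, f (x s) (u s))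

/-- `u` is an admissible input on `[0,∞)`: it is (a.e. strongly) measurable and
locally essentially bounded, i.e. on each compact subinterval of `[0,∞)` it
takes values, up to a null set, in a compact subset of `U`. -/
def IsInput {U : Type*} [MetricSpace U] (u : ℝ → U) : Prop :=
  AEStronglyMeasurable u (volume.restrict (Ici (0:ℝ))) ∧
  ∀ I₀ : Set ℝ, IsCompact I₀ → I₀ ⊆ Ici 0 →
    ∃ K₀ : Set U, IsCompact K₀ ∧ ∀ᵐ t ∂(volume.restrict I₀), u t ∈ K₀

/-- The (essential) sup norm `‖u‖ = ess sup_{t ≥ 0} dist (u t) ubar` is `< δ`. -/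
def SupNormLt {U : Type*} [MetricSpace U] (u : ℝ → U) (ubar : U) (δ : ℝ) : Prop :=
  ∃ b, b < δ ∧ ∀ᵐ t ∂(volume.restrict (Ici (0:ℝ))), dist (u t) ubar ≤ b


theorem cics_gronwall_cont {w : ℝ → ℝ} {a L T : ℝ} (hL : 0 ≤ L) (hw : Continuous w)
    (h : ∀ t ∈ Icc 0 T, w t ≤ a + L * ∫ s in (0:ℝ)..t, w s) (hT : 0 ≤ T) :
    w T ≤ a * Real.exp (L * T) := by
  have hd : ∀ t, HasDerivAt (fun t => a + L * ∫ s in (0:ℝ)..t, w s) (L * w t) t := by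
    intro t
    exact ((hw.integral_hasStrictDerivAt 0 t).hasDerivAt.const_mul L).const_add a
  have key := le_gronwallBound_of_liminf_deriv_right_le (f := fun t => a + L * ∫ s in (0:ℝ)..t, w s)
    (f' := fun t => L * w t) (δ := a) (K := L) (ε := 0) (a := 0) (b := T)
    (fun t _ => (hd t).continuousAt.continuousWithinAt)
    (fun x _ r hr => ((hd x).hasDerivWithinAt (s := Ici x)).liminf_right_slope_le hr)
    (by simp) (fun x hx => by
      have := mul_le_mul_of_nonneg_left (h x ⟨hx.1, hx.2.le⟩) hL
      simpa using this) T ⟨hT, le_rfl⟩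
  rw [gronwallBound_ε0, sub_zero] at key
  exact (h T ⟨hT, le_rfl⟩).trans key

theorem cics_gronwall {w : ℝ → ℝ} {a L T : ℝ} (hL : 0 ≤ L) (hw : ContinuousOn w (Icc 0 T))
    (h : ∀ t ∈ Icc 0 T, w t ≤ a + L * ∫ s in (0:ℝ)..t, w s) (hT : 0 ≤ T) :
    w T ≤ a * Real.exp (L * T) := by
  have hc : Continuous (IccExtend hT ((Icc 0 T).domRestrict w)) :=
    (continuousOn_iff_continuous_domRestrict.1 hw).Icc_extend'
  have he : ∀ t ∈ Icc 0 T, IccExtend hT ((Icc 0 T).domRestrict w) t = w t := by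
    intro t ht
    rw [IccExtend_of_mem _ _ ht]; rfl
  have := cics_gronwall_cont (a := a) hL hc (T := T) (fun t ht => by
    rw [he t ht]
    refine (h t ht).trans (le_of_eq ?_)
    congr 2
    refine intervalIntegral.integral_congr fun s hs => ?_
    rw [uIcc_of_le ht.1] at hs
    exact (he s ⟨hs.1, hs.2.trans ht.2⟩).symm) hT
  rwa [he T ⟨hT, le_rfl⟩] at this

theorem cics_lip {E U : Type*} [NormedAddCommGroup E] [NormedSpace ℝ E] [MetricSpace U]
    {X : Set E} {f : E → U → E}
    (hfc : ContinuousOn (fun p : E × U => f p.1 p.2) (X ×ˢ (univ : Set U)))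
    (hflip : ∀ ξ ∈ X, ∀ K₀ : Set U, IsCompact K₀ → ∃ V ∈ 𝓝 ξ, ∃ L : ℝ,
      ∀ x ∈ V, ∀ z ∈ V, ∀ μ ∈ K₀, ‖f x μ - f z μ‖ ≤ L * ‖x - z‖)
    {N : Set E} (hN : IsCompact N) (hNX : N ⊆ X) {K₀ : Set U} (hK : IsCompact K₀) :
    ∃ L, 0 ≤ L ∧ (∀ x ∈ N, ∀ μ ∈ K₀, ‖f x μ‖ ≤ L) ∧
      ∀ x ∈ N, ∀ z ∈ N, ∀ μ ∈ K₀, ‖f x μ - f z μ‖ ≤ L * ‖x - z‖ := by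
  obtain ⟨M, hM⟩ := (hN.prod hK).exists_bound_of_continuousOn
    (hfc.mono (prod_mono hNX (subset_univ _)))
  have hM' : ∀ x ∈ N, ∀ μ ∈ K₀, ‖f x μ‖ ≤ M := fun x hx μ hμ => hM (x, μ) ⟨hx, hμ⟩
  have key : ∃ L, ∀ p ∈ N ×ˢ N, p.1 ∈ N → p.2 ∈ N → ∀ μ ∈ K₀,
      ‖f p.1 μ - f p.2 μ‖ ≤ L * ‖p.1 - p.2‖ := by
    refine (hN.prod hN).induction_on (p := fun S => ∃ L, ∀ p ∈ S, p.1 ∈ N → p.2 ∈ N → ∀ μ ∈ K₀,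
      ‖f p.1 μ - f p.2 μ‖ ≤ L * ‖p.1 - p.2‖) ⟨0, by simp⟩ ?_ ?_ ?_
    · rintro s t hst ⟨L, h⟩
      exact ⟨L, fun p hp => h p (hst hp)⟩
    · rintro s t ⟨L, h⟩ ⟨L', h'⟩
      refine ⟨max L L', ?_⟩
      rintro p (hp | hp) h1 h2 μ hμ
      · exact (h p hp h1 h2 μ hμ).trans (by gcongr; exact le_max_left _ _)
      · exact (h' p hp h1 h2 μ hμ).trans (by gcongr; exact le_max_right _ _)
    · rintro ⟨x, z⟩ ⟨hx, hz⟩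
      by_cases hxz : x = z
      · subst hxz
        obtain ⟨V, hV, L, h⟩ := hflip x (hNX hx) K₀ hK
        exact ⟨V ×ˢ V, mem_nhdsWithin_of_mem_nhds (prod_mem_nhds hV hV), L,
          fun p hp _ _ μ hμ => h p.1 hp.1 p.2 hp.2 μ hμ⟩
      · have hd : 0 < ‖x - z‖ := norm_pos_iff.2 (sub_ne_zero.2 hxz)
        have hev : ∀ᶠ p : E × E in 𝓝 (x, z), ‖x - z‖ / 2 < ‖p.1 - p.2‖ :=
          (Continuous.continuousAt (by fun_prop)).eventually_const_lt
            (by simpa using half_lt_self hd)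
        refine ⟨_, mem_nhdsWithin_of_mem_nhds hev, 2 * M / (‖x - z‖ / 2), ?_⟩
        intro p hp h1 h2 μ hμ
        have hp' : ‖x - z‖ / 2 < ‖p.1 - p.2‖ := hp
        have hb1 := hM' _ h1 μ hμ
        have hb2 := hM' _ h2 μ hμ
        have hM0 : 0 ≤ M := (norm_nonneg _).trans hb1
        calc ‖f p.1 μ - f p.2 μ‖ ≤ ‖f p.1 μ‖ + ‖f p.2 μ‖ := norm_sub_le _ _
          _ ≤ 2 * M := by linarith
          _ = 2 * M / (‖x - z‖ / 2) * (‖x - z‖ / 2) := by field_simp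
          _ ≤ _ := by gcongr
  obtain ⟨L, hL⟩ := key
  refine ⟨max (max L M) 0, le_max_right _ _, fun x hx μ hμ => (hM' x hx μ hμ).trans ?_,
    fun x hx z hz μ hμ => (hL (x, z) ⟨hx, hz⟩ hx hz μ hμ).trans ?_⟩
  · exact (le_max_right _ _).trans (le_max_left _ _)
  · dsimp only
    gcongr
    exact (le_max_left _ _).trans (le_max_left _ _)

theorem cics_intervalIntegrable {E : Type*} [NormedAddCommGroup E] {h : ℝ → E}
    (hm : AEStronglyMeasurable h volume)
    (hb : ∀ T : ℝ, ∃ L : ℝ, ∀ᵐ s : ℝ, s ≤ T → ‖h s‖ ≤ L) (a b : ℝ) :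
    IntervalIntegrable h volume a b := by
  obtain ⟨L, hL⟩ := hb (max a b)
  refine (intervalIntegrable_const (c := L)).mono_fun hm.restrict ?_
  refine (ae_restrict_iff' measurableSet_uIoc).2 ?_
  filter_upwards [hL] with s hs hs'
  exact (hs hs'.2).trans (le_abs_self L)

theorem cics_picard {E : Type*} [NormedAddCommGroup E] [NormedSpace ℝ E] [CompleteSpace E]
    (G : ℝ → E → E)
    (hm : ∀ y : ℝ → E, Continuous y → AEStronglyMeasurable (fun s => G s (y s)) volume)
    (hneg : ∀ s ≤ 0, ∀ x, G s x = 0)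
    (hG : ∀ T : ℝ, ∃ L : ℝ, 0 ≤ L ∧ ∀ᵐ s : ℝ, s ≤ T → (∀ x, ‖G s x‖ ≤ L) ∧
      ∀ x z, ‖G s x - G s z‖ ≤ L * ‖x - z‖) (ξ : E) :
    ∃ y : ℝ → E, Continuous y ∧
      (∀ a b, IntervalIntegrable (fun s => G s (y s)) volume a b) ∧
      ∀ t, y t = ξ + ∫ s in (0:ℝ)..t, G s (y s) := by
  obtain ⟨Y, hY0, hYs⟩ : ∃ Y : ℕ → ℝ → E, (Y 0 = fun _ => ξ) ∧
      ∀ k t, Y (k+1) t = ξ + ∫ s in (0:ℝ)..t, G s (Y k s) :=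
    ⟨fun k => Nat.rec (fun _ => ξ) (fun _ y t => ξ + ∫ s in (0:ℝ)..t, G s (y s)) k,
      rfl, fun _ _ => rfl⟩
  have hint : ∀ y : ℝ → E, AEStronglyMeasurable (fun s => G s (y s)) volume →
      ∀ a b, IntervalIntegrable (fun s => G s (y s)) volume a b := by
    intro y hy a b
    refine cics_intervalIntegrable hy (fun T => ?_) a b
    obtain ⟨L, -, h⟩ := hG T
    exact ⟨L, h.mono fun s hs hsT => (hs hsT).1 _⟩
  have hYc : ∀ k, Continuous (Y k) := by
    intro k
    induction k with
    | zero => rw [hY0]; exact continuous_const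
    | succ k ih =>
      rw [funext (hYs k)]
      exact continuous_const.add
        (intervalIntegral.continuous_primitive (hint _ (hm _ ih)) 0)
  have hYneg : ∀ k, ∀ t ≤ 0, Y k t = ξ := by
    intro k t ht
    cases k with
    | zero => rw [hY0]
    | succ k =>
      rw [hYs, intervalIntegral.integral_zero_ae, add_zero]
      refine Eventually.of_forall fun s hs => hneg s ?_ _
      rw [uIoc_of_ge ht] at hs
      exact hs.2
  have hdiff : ∀ T L : ℝ, 0 ≤ L → (∀ᵐ s : ℝ, s ≤ T → (∀ x, ‖G s x‖ ≤ L) ∧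
      ∀ x z, ‖G s x - G s z‖ ≤ L * ‖x - z‖) → ∀ k, ∀ t ∈ Icc 0 T,
      ‖Y (k+1) t - Y k t‖ ≤ (L * t) ^ (k+1) / (k+1).factorial := by
    intro T L hL h k
    induction k with
    | zero =>
      intro t ht
      have : ‖∫ s in (0:ℝ)..t, G s (Y 0 s)‖ ≤ L * |t - 0| := by
        refine intervalIntegral.norm_integral_le_of_norm_le_const_ae ?_
        filter_upwards [h] with s hs hs'
        rw [uIoc_of_le ht.1] at hs'
        exact (hs (hs'.2.trans ht.2)).1 _
      rw [hYs]
      simpa [hY0, abs_of_nonneg ht.1] using this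
    | succ k ih =>
      intro t ht
      rw [hYs (k+1), hYs k, add_sub_add_left_eq_sub,
        ← intervalIntegral.integral_sub (hint _ (hm _ (hYc (k+1))) _ _)
          (hint _ (hm _ (hYc k)) _ _)]
      have : ‖∫ s in (0:ℝ)..t, (G s (Y (k+1) s) - G s (Y k s))‖ ≤
          ∫ s in (0:ℝ)..t, L * ((L * s) ^ (k+1) / (k+1).factorial) := by
        refine intervalIntegral.norm_integral_le_of_norm_le ht.1 ?_
          (Continuous.intervalIntegrable (by fun_prop) _ _)
        filter_upwards [h] with s hs hs'
        refine ((hs (hs'.2.trans ht.2)).2 _ _).trans ?_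
        gcongr
        exact ih s ⟨hs'.1.le, hs'.2.trans ht.2⟩
      refine this.trans (le_of_eq ?_)
      have e : (fun s : ℝ => L * ((L * s) ^ (k+1) / (k+1).factorial)) =
          fun s => (L ^ (k+2) / (k+1).factorial) * s ^ (k+1) := by
        funext s; rw [mul_pow]; ring
      rw [e, intervalIntegral.integral_const_mul, integral_pow, Nat.factorial_succ (k+1)]
      push_cast
      have : ((k+1).factorial : ℝ) ≠ 0 := by positivity
      field_simp
      simp
      ring
  have hlim : ∀ t, ∃ l, Tendsto (fun k => Y k t) atTop (𝓝 l) := by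
    intro t
    rcases le_total t 0 with ht | ht
    · exact ⟨ξ, by simp [hYneg _ t ht]⟩
    · obtain ⟨L, hL, h⟩ := hG t
      refine cauchySeq_tendsto_of_complete (cauchySeq_of_dist_le_of_summable
        (fun k => (L * t) ^ (k+1) / (k+1).factorial) (fun k => ?_) ?_)
      · rw [dist_comm, dist_eq_norm]
        exact hdiff t L hL h k t ⟨ht, le_rfl⟩
      · exact (summable_nat_add_iff 1).2 (Real.summable_pow_div_factorial (L * t))
  choose y hy using hlim
  have hGlim : ∀ T : ℝ, ∀ᵐ s : ℝ, s ≤ T →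
      Tendsto (fun k => G s (Y k s)) atTop (𝓝 (G s (y s))) := by
    intro T
    obtain ⟨L, hL, h⟩ := hG T
    filter_upwards [h] with s hs hsT
    rw [tendsto_iff_norm_sub_tendsto_zero]
    refine squeeze_zero (fun _ => norm_nonneg _) (fun k => (hs hsT).2 _ _) ?_
    simpa using (tendsto_iff_norm_sub_tendsto_zero.1 (hy s)).const_mul L
  have hGlim' : ∀ᵐ s : ℝ, Tendsto (fun k => G s (Y k s)) atTop (𝓝 (G s (y s))) := by
    have := ae_all_iff.2 (fun n : ℕ => hGlim n)
    filter_upwards [this] with s hs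
    obtain ⟨n, hn⟩ := exists_nat_ge s
    exact hs n hn
  have hym : AEStronglyMeasurable (fun s => G s (y s)) volume :=
    aestronglyMeasurable_of_tendsto_ae atTop (fun k => hm _ (hYc k)) hGlim'
  have heq : ∀ t, y t = ξ + ∫ s in (0:ℝ)..t, G s (y s) := by
    intro t
    obtain ⟨L, hL, h⟩ := hG (max 0 t)
    have h1 : Tendsto (fun k => ∫ s in (0:ℝ)..t, G s (Y k s)) atTop
        (𝓝 (∫ s in (0:ℝ)..t, G s (y s))) := by
      refine intervalIntegral.tendsto_integral_filter_of_dominated_convergence (fun _ => L)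
        (Eventually.of_forall fun k => (hm _ (hYc k)).restrict) (Eventually.of_forall fun k => ?_)
        intervalIntegrable_const (hGlim'.mono fun s hs _ => hs)
      filter_upwards [h] with s hs hs'
      exact (hs hs'.2).1 _
    exact tendsto_nhds_unique ((tendsto_add_atTop_iff_nat 1).2 (hy t))
      (by simpa only [hYs] using h1.const_add ξ)
  refine ⟨y, ?_, hint _ hym, heq⟩
  have : y = fun t => ξ + ∫ s in (0:ℝ)..t, G s (y s) := funext heq
  rw [this]
  exact continuous_const.add (intervalIntegral.continuous_primitive (hint _ hym) 0)

theorem cics_cutoff {E : Type*} [NormedAddCommGroup E] {C : Set E} (hC : IsCompact C)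
    (hne : C.Nonempty) {r : ℝ} (hr : 0 < r) :
    ∃ χ : E → ℝ, Continuous χ ∧ (∀ x, 0 ≤ χ x) ∧ (∀ x, χ x ≤ 1) ∧ (∀ x ∈ C, χ x = 1) ∧
      (∀ x, x ∉ cthickening r C → χ x = 0) ∧ ∀ x z, |χ x - χ z| ≤ r⁻¹ * ‖x - z‖ := by
  refine ⟨fun x => max (1 - infDist x C / r) 0, ?_, fun x => le_max_right _ _, fun x => ?_,
    fun x hx => ?_, fun x hx => ?_, fun x z => ?_⟩
  · have := continuous_infDist_pt C
    fun_prop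
  · have : 0 ≤ infDist x C / r := div_nonneg infDist_nonneg hr.le
    exact max_le (by linarith) zero_le_one
  · simp [infDist_zero_of_mem hx]
  · apply max_eq_right
    rw [sub_nonpos, one_le_div hr]
    by_contra hlt
    obtain ⟨y, hy, hxy⟩ := hC.exists_infDist_eq_dist hne x
    exact hx (mem_cthickening_of_dist_le x y r C hy (by rw [← hxy]; exact (not_le.1 hlt).le))
  · refine (abs_max_sub_max_le_abs _ _ _).trans ?_
    have h1 : infDist x C ≤ infDist z C + dist x z := infDist_le_infDist_add_dist
    have h2 : infDist z C ≤ infDist x C + dist z x := infDist_le_infDist_add_dist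
    rw [dist_comm z x] at h2
    rw [← dist_eq_norm]
    have e : 1 - infDist x C / r - (1 - infDist z C / r) =
        r⁻¹ * (infDist z C - infDist x C) := by ring
    rw [e, abs_mul, abs_of_pos (inv_pos.2 hr)]
    gcongr
    exact abs_le.2 ⟨by linarith, by linarith⟩

theorem cics_exist {E U : Type*} [NormedAddCommGroup E] [NormedSpace ℝ E] [ProperSpace E]
    [MetricSpace U] {X : Set E} {f : E → U → E} (hX : IsOpen X)
    (hfc : ContinuousOn (fun p : E × U => f p.1 p.2) (X ×ˢ (univ : Set U)))
    (hflip : ∀ ξ ∈ X, ∀ K₀ : Set U, IsCompact K₀ → ∃ V ∈ 𝓝 ξ, ∃ L : ℝ,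
      ∀ x ∈ V, ∀ z ∈ V, ∀ μ ∈ K₀, ‖f x μ - f z μ‖ ≤ L * ‖x - z‖)
    {C : Set E} (hC : IsCompact C) (hCX : C ⊆ X) {u : ℝ → U} (hu : IsInput u) (ξ : E) :
    ∃ x H : ℝ → E, Continuous x ∧ x 0 = ξ ∧ (∀ a b, IntervalIntegrable H volume a b) ∧
      (∀ t, x t = x 0 + ∫ s in (0:ℝ)..t, H s) ∧ ∀ s > 0, x s ∈ C → H s = f (x s) (u s) := by
  rcases C.eq_empty_or_nonempty with rfl | hne
  · exact ⟨fun _ => ξ, fun _ => 0, continuous_const, rfl, fun _ _ => intervalIntegrable_const,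
      by simp, by simp⟩
  obtain ⟨r, hr, hrX⟩ := hC.exists_cthickening_subset_open hX hCX
  have hC' : IsCompact (cthickening r C) := hC.cthickening
  obtain ⟨χ, hχc, hχ0, hχ1, hχC, hχout, hχl⟩ := cics_cutoff hC hne hr
  have hgc : Continuous (fun p : E × U => χ p.1 • f p.1 p.2) := by
    rw [continuous_iff_continuousAt]
    rintro ⟨x, μ⟩
    by_cases hx : x ∈ X
    · have h1 : ContinuousAt (fun p : E × U => f p.1 p.2) (x, μ) :=
        hfc.continuousAt ((hX.prod isOpen_univ).mem_nhds ⟨hx, mem_univ _⟩)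
      exact (hχc.comp continuous_fst).continuousAt.smul h1
    · have hx' : x ∉ cthickening r C := fun h => hx (hrX h)
      have hev : ∀ᶠ p : E × U in 𝓝 (x, μ), χ p.1 • f p.1 p.2 = 0 := by
        have : ∀ᶠ z in 𝓝 x, z ∈ (cthickening r C)ᶜ := isClosed_cthickening.isOpen_compl.mem_nhds hx'
        filter_upwards [continuousAt_fst.eventually this] with p hp
        rw [hχout _ hp, zero_smul]
      exact continuousAt_const.congr (hev.mono fun _ h => h.symm)
  have hpic := cics_picard (fun s x => if 0 < s then χ x • f x (u s) else 0) (ξ := ξ)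
  obtain ⟨x, hxc, hxi, hx⟩ := by
    refine hpic ?_ ?_ ?_
    · intro y hy
      have : (fun s => if 0 < s then χ (y s) • f (y s) (u s) else 0) =
          (Ioi (0:ℝ)).indicator (fun s => χ (y s) • f (y s) (u s)) := by
        funext s; simp [indicator]
      rw [this, aestronglyMeasurable_indicator_iff measurableSet_Ioi]
      have hu' : AEStronglyMeasurable u (volume.restrict (Ioi (0:ℝ))) :=
        hu.1.mono_set Ioi_subset_Ici_self
      exact hgc.comp_aestronglyMeasurable (hy.aestronglyMeasurable.prodMk hu')
    · intro s hs x
      exact if_neg (not_lt.2 hs)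
    · intro T
      obtain ⟨K₀, hK₀, hK₀u⟩ := hu.2 (Icc 0 T) isCompact_Icc (fun s hs => hs.1)
      rw [ae_restrict_iff' measurableSet_Icc] at hK₀u
      obtain ⟨L, hL, hLb, hLl⟩ := cics_lip hfc hflip hC' hrX hK₀
      refine ⟨L + r⁻¹ * L, by positivity, ?_⟩
      have hr' : 0 ≤ r⁻¹ * L := by positivity
      filter_upwards [hK₀u] with s hs hsT
      by_cases h0 : 0 < s
      swap
      · simp only [if_neg h0, norm_zero, sub_self]
        exact ⟨fun _ => by positivity, fun _ _ => by positivity⟩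
      simp only [if_pos h0]
      have hus := hs ⟨h0.le, hsT⟩
      have hone : ∀ x ∈ cthickening r C, ∀ z, z ∉ cthickening r C →
          ‖χ x • f x (u s)‖ ≤ (L + r⁻¹ * L) * ‖x - z‖ := by
        intro x hx z hz
        have h1 := hχl x z
        rw [hχout z hz, sub_zero] at h1
        rw [norm_smul, Real.norm_eq_abs]
        calc |χ x| * ‖f x (u s)‖ ≤ (r⁻¹ * ‖x - z‖) * L := by
              gcongr; exact hLb x hx _ hus
          _ ≤ (L + r⁻¹ * L) * ‖x - z‖ := by nlinarith [norm_nonneg (x - z)]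
      refine ⟨fun x => ?_, fun x z => ?_⟩
      · by_cases hx : x ∈ cthickening r C
        · rw [norm_smul, Real.norm_eq_abs, abs_of_nonneg (hχ0 x)]
          have := hLb x hx _ hus
          nlinarith [hχ0 x, hχ1 x, norm_nonneg (f x (u s))]
        · rw [hχout x hx, zero_smul, norm_zero]; positivity
      · by_cases hx : x ∈ cthickening r C <;> by_cases hz : z ∈ cthickening r C
        · have e : χ x • f x (u s) - χ z • f z (u s) =
              χ x • (f x (u s) - f z (u s)) + (χ x - χ z) • f z (u s) := by
            rw [smul_sub, sub_smul]; abel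
          rw [e]
          refine (norm_add_le _ _).trans ?_
          rw [norm_smul, norm_smul, Real.norm_eq_abs, Real.norm_eq_abs, abs_of_nonneg (hχ0 x)]
          calc χ x * ‖f x (u s) - f z (u s)‖ + |χ x - χ z| * ‖f z (u s)‖
              ≤ 1 * (L * ‖x - z‖) + (r⁻¹ * ‖x - z‖) * L := by
                gcongr
                · exact hχ1 x
                · exact hLl x hx z hz _ hus
                · exact hχl x z
                · exact hLb z hz _ hus
            _ = _ := by ring
        · rw [hχout z hz, zero_smul, sub_zero]
          exact hone x hx z hz
        · rw [hχout x hx, zero_smul, zero_sub, norm_neg, norm_sub_rev x z]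
          exact hone z hz x hx
        · rw [hχout z hz, hχout x hx, zero_smul, zero_smul, sub_zero, norm_zero]
          positivity
  have hx0 : x 0 = ξ := by simpa using hx 0
  refine ⟨x, _, hxc, hx0, hxi, fun t => by rw [hx0]; exact hx t, fun s hs hsC => ?_⟩
  simp only [if_pos hs, hχC _ hsC, one_smul]

/-- `x` is an absolutely continuous curve with derivative `H` which follows `f(x, v)` as long as
`x` lies in `C`, the input `v` being `δ`-close to `ubar`. -/
structure CicsTrack {E U : Type*} [NormedAddCommGroup E] [NormedSpace ℝ E] [MetricSpace U]
    (f : E → U → E) (ubar : U) (C : Set E) (δ : ℝ) (x H : ℝ → E) (v : ℝ → U) : Prop where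
  cont : ContinuousOn x (Ici 0)
  int : ∀ t ≥ 0, IntervalIntegrable H volume 0 t
  eq : ∀ t ≥ 0, x t = x 0 + ∫ s in (0:ℝ)..t, H s
  der : ∀ s > 0, x s ∈ C → H s = f (x s) (v s)
  small : ∀ᵐ s : ℝ, 0 ≤ s → dist (v s) ubar < δ

theorem CicsTrack.mono {E U : Type*} [NormedAddCommGroup E] [NormedSpace ℝ E] [MetricSpace U]
    {f : E → U → E} {ubar : U} {C C' : Set E} {δ δ' : ℝ} {x H : ℝ → E} {v : ℝ → U}
    (h : CicsTrack f ubar C δ x H v) (hC : C' ⊆ C) (hδ : δ ≤ δ') :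
    CicsTrack f ubar C' δ' x H v :=
  ⟨h.cont, h.int, h.eq, fun s hs hx => h.der s hs (hC hx),
    h.small.mono fun _ hs h0 => (hs h0).trans_le hδ⟩

theorem CicsTrack.shift {E U : Type*} [NormedAddCommGroup E] [NormedSpace ℝ E] [MetricSpace U]
    {f : E → U → E} {ubar : U} {C : Set E} {δ : ℝ} {x H : ℝ → E} {v : ℝ → U}
    (h : CicsTrack f ubar C δ x H v) {a : ℝ} (ha : 0 ≤ a) :
    CicsTrack f ubar C δ (fun t => x (a + t)) (fun t => H (a + t)) (fun t => v (a + t)) := by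
  have hi : ∀ t ≥ 0, IntervalIntegrable H volume a (a + t) := fun t ht =>
    (h.int a ha).symm.trans (h.int (a + t) (add_nonneg ha ht))
  refine ⟨?_, fun t ht => ?_, fun t ht => ?_, fun s hs hx => h.der _ (by positivity) hx, ?_⟩
  · exact h.cont.comp (by fun_prop) (fun t ht => add_nonneg ha ht)
  · have := (hi t ht).comp_add_left a
    simpa using this
  · rw [intervalIntegral.integral_comp_add_left (fun s => H s) a]
    simp only [add_zero]
    rw [h.eq _ (add_nonneg ha ht), h.eq a ha, add_assoc,
      intervalIntegral.integral_add_adjacent_intervals (h.int a ha) (hi t ht)]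
  · have := (measurePreserving_add_left volume a).quasiMeasurePreserving.ae h.small
    filter_upwards [this] with s hs h0
    exact hs (add_nonneg ha h0)

theorem cics_unif {E U : Type*} [NormedAddCommGroup E] [MetricSpace U]
    {X : Set E} {f : E → U → E} (hX : IsOpen X)
    (hfc : ContinuousOn (fun p : E × U => f p.1 p.2) (X ×ˢ (univ : Set U)))
    {N : Set E} (hN : IsCompact N) (hNX : N ⊆ X) (ubar : U) {a : ℝ} (ha : 0 < a) :
    ∃ δ > 0, ∀ x ∈ N, ∀ μ, dist μ ubar < δ → ‖f x μ - f x ubar‖ ≤ a := by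
  refine hN.induction_on (p := fun S => ∃ δ > 0, ∀ x ∈ S, ∀ μ, dist μ ubar < δ →
    ‖f x μ - f x ubar‖ ≤ a) ⟨1, one_pos, by simp⟩ ?_ ?_ ?_
  · rintro s t hst ⟨δ, hδ, h⟩
    exact ⟨δ, hδ, fun x hx => h x (hst hx)⟩
  · rintro s t ⟨δ, hδ, h⟩ ⟨δ', hδ', h'⟩
    refine ⟨min δ δ', lt_min hδ hδ', ?_⟩
    rintro x (hx | hx) μ hμ
    · exact h x hx μ (hμ.trans_le (min_le_left _ _))
    · exact h' x hx μ (hμ.trans_le (min_le_right _ _))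
  · intro x hx
    have h1 : ContinuousAt (fun p : E × U => f p.1 p.2) (x, ubar) :=
      hfc.continuousAt ((hX.prod isOpen_univ).mem_nhds ⟨hNX hx, mem_univ _⟩)
    obtain ⟨δ, hδ, h⟩ := Metric.continuousAt_iff.1 h1 (a / 2) (by positivity)
    refine ⟨ball x δ, mem_nhdsWithin_of_mem_nhds (ball_mem_nhds x hδ), δ, hδ, ?_⟩
    intro z hz μ hμ
    have a1 := h (x := (z, μ)) (by rw [Prod.dist_eq]; exact max_lt hz hμ)
    have a2 := h (x := (z, ubar)) (by rw [Prod.dist_eq]; exact max_lt hz (by simpa using hδ))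
    rw [← dist_eq_norm]
    dsimp only at a1 a2
    linarith [dist_triangle_right (f z μ) (f z ubar) (f x ubar)]

theorem cics_track {E U : Type*} [NormedAddCommGroup E] [NormedSpace ℝ E] [ProperSpace E]
    [MetricSpace U] {X : Set E} {f : E → U → E} (hX : IsOpen X)
    (hfc : ContinuousOn (fun p : E × U => f p.1 p.2) (X ×ˢ (univ : Set U)))
    (hflip : ∀ ξ ∈ X, ∀ K₀ : Set U, IsCompact K₀ → ∃ V ∈ 𝓝 ξ, ∃ L : ℝ,
      ∀ x ∈ V, ∀ z ∈ V, ∀ μ ∈ K₀, ‖f x μ - f z μ‖ ≤ L * ‖x - z‖) (ubar : U)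
    {y : ℝ → E} (hyc : ContinuousOn y (Ici 0)) (hyX : ∀ t ∈ Ici (0:ℝ), y t ∈ X)
    (hyi : ∀ t ∈ Ici (0:ℝ), IntervalIntegrable (fun s => f (y s) ubar) volume 0 t)
    (hy : ∀ t ∈ Ici (0:ℝ), y t = y 0 + ∫ s in (0:ℝ)..t, f (y s) ubar)
    {T η : ℝ} (hT : 0 ≤ T) (hη : 0 < η) :
    ∃ N : Set E, IsCompact N ∧ N ⊆ X ∧ ∃ r > 0, ∃ δ > 0, ∀ x H v, CicsTrack f ubar N δ x H v →
      dist (x 0) (y 0) ≤ r → ∀ t ∈ Icc 0 T, x t ∈ N ∧ dist (x t) (y t) < η := by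
  have hA : IsCompact (y '' Icc 0 T) := isCompact_Icc.image_of_continuousOn
    (hyc.mono fun t ht => ht.1)
  obtain ⟨η₁, hη₁, hsub⟩ := hA.exists_cthickening_subset_open hX
    (by rintro _ ⟨t, ht, rfl⟩; exact hyX t ht.1)
  set η' := min η η₁ with hη'def
  have hη' : 0 < η' := lt_min hη hη₁
  set N := cthickening η' (y '' Icc 0 T) with hNdef
  have hN : IsCompact N := hA.cthickening
  have hNX : N ⊆ X := (cthickening_mono (min_le_right _ _) _).trans hsub
  have hmemN : ∀ t ∈ Icc 0 T, ∀ z, dist z (y t) ≤ η' → z ∈ N := fun t ht z hz =>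
    mem_cthickening_of_dist_le z (y t) η' _ (mem_image_of_mem y ht) hz
  obtain ⟨L, hL, -, hLl⟩ := cics_lip hfc hflip hN hNX (isCompact_singleton (x := ubar))
  obtain ⟨a, ha, haη⟩ : ∃ a > 0, (a + a * T) * Real.exp (L * T) < η' := by
    refine ⟨η' / (2 * ((1 + T) * Real.exp (L * T))), by positivity, ?_⟩
    have : (1 + T) * Real.exp (L * T) ≠ 0 := by positivity
    have e : (η' / (2 * ((1 + T) * Real.exp (L * T))) + η' / (2 * ((1 + T) * Real.exp (L * T))) * T)
        * Real.exp (L * T) = η' / 2 := by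
      field_simp
    rw [e]; linarith
  obtain ⟨δ, hδ, hδf⟩ := cics_unif hX hfc hN hNX ubar ha
  refine ⟨N, hN, hNX, a, ha, δ, hδ, fun x H v hx hx0 => ?_⟩
  suffices hall : ∀ t ∈ Icc 0 T, dist (x t) (y t) < η' from fun t ht =>
    ⟨hmemN t ht _ (hall t ht).le, (hall t ht).trans_le (min_le_left _ _)⟩
  have hwc : ContinuousOn (fun t => dist (x t) (y t)) (Ici 0) := continuous_dist.comp_continuousOn (hx.cont.prodMk hyc)
  -- a priori estimate
  have hap : ∀ t ∈ Icc 0 T, (∀ s ∈ Ioo 0 t, dist (x s) (y s) ≤ η') → dist (x t) (y t) < η' := by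
    intro t ht hs
    refine lt_of_le_of_lt ?_ haη
    have hg := cics_gronwall (w := fun t => dist (x t) (y t)) (a := a + a * T) hL (T := t)
      (hwc.mono fun s hs => hs.1) ?_ ht.1
    · refine hg.trans ?_
      gcongr
      exact ht.2
    intro τ hτ
    have hτT : τ ≤ T := hτ.2.trans ht.2
    have hwi : IntervalIntegrable (fun s => dist (x s) (y s)) volume 0 τ :=
      (hwc.mono (fun s hs => by rw [uIcc_of_le hτ.1] at hs; exact hs.1)).intervalIntegrable
    have e : x τ - y τ = (x 0 - y 0) + ∫ s in (0:ℝ)..τ, (H s - f (y s) ubar) := by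
      rw [intervalIntegral.integral_sub (hx.int τ hτ.1) (hyi τ hτ.1), hx.eq τ hτ.1, hy τ hτ.1]
      abel
    have hb : ‖∫ s in (0:ℝ)..τ, (H s - f (y s) ubar)‖ ≤
        ∫ s in (0:ℝ)..τ, (a + L * dist (x s) (y s)) := by
      refine intervalIntegral.norm_integral_le_of_norm_le hτ.1 ?_
        (intervalIntegrable_const.add (hwi.const_mul L))
      have hne : ∀ᵐ s : ℝ, s ≠ τ := by
        simp [ae_iff]
      filter_upwards [hx.small, hne] with s hsv hsτ hs'
      have hs0 : s ∈ Icc 0 T := ⟨hs'.1.le, hs'.2.trans hτT⟩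
      have hlt : s < t := (lt_of_le_of_ne hs'.2 hsτ).trans_le hτ.2
      have hxN : x s ∈ N := hmemN s hs0 _ (hs s ⟨hs'.1, hlt⟩)
      have hyN : y s ∈ N := hmemN s hs0 _ (by simpa using hη'.le)
      rw [hx.der s hs'.1 hxN, ← sub_add_sub_cancel _ (f (x s) ubar), dist_eq_norm]
      exact (norm_add_le _ _).trans (add_le_add (hδf _ hxN _ (hsv hs'.1.le))
        (hLl _ hxN _ hyN _ rfl))
    rw [intervalIntegral.integral_add intervalIntegrable_const (hwi.const_mul L),
      intervalIntegral.integral_const_mul, intervalIntegral.integral_const] at hb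
    simp only [sub_zero, smul_eq_mul] at hb
    have h1 : dist (x τ) (y τ) ≤ dist (x 0) (y 0) + ‖∫ s in (0:ℝ)..τ, (H s - f (y s) ubar)‖ := by
      rw [dist_eq_norm, dist_eq_norm, e]; exact norm_add_le _ _
    have h2 : τ * a ≤ a * T := by rw [mul_comm]; gcongr
    show dist (x τ) (y τ) ≤ _
    linarith
  by_contra! hcon
  obtain ⟨t₀, ht₀, hbad⟩ := hcon
  have hcl : IsCompact {t | t ∈ Icc 0 T ∧ η' ≤ dist (x t) (y t)} := by
    have := (hwc.mono (fun t ht => ht.1 : Icc 0 T ⊆ Ici 0)).preimage_isClosed_of_isClosed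
      isClosed_Icc (isClosed_Ici (a := η'))
    exact isCompact_Icc.of_isClosed_subset this (fun t ht => ht.1)
  obtain ⟨t₁, ht₁, hleast⟩ := hcl.exists_isLeast ⟨t₀, ht₀, hbad⟩
  refine absurd (hap t₁ ht₁.1 fun s hs => ?_) (not_lt.2 ht₁.2)
  by_contra! hlt
  exact absurd (hleast ⟨⟨hs.1.le, hs.2.le.trans ht₁.1.2⟩, hlt.le⟩) (not_le.2 hs.2)

theorem cics_local_unif {n : ℕ} {U : Type*} [MetricSpace U]
    {X : Set (EuclideanSpace ℝ (Fin n))}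
    {f : EuclideanSpace ℝ (Fin n) → U → EuclideanSpace ℝ (Fin n)}
    {xbar : EuclideanSpace ℝ (Fin n)} {ubar : U}
    (hX : IsOpen X)
    (hfc : ContinuousOn (fun p : EuclideanSpace ℝ (Fin n) × U => f p.1 p.2)
      (X ×ˢ (univ : Set U)))
    (hflip : ∀ ξ ∈ X, ∀ K₀ : Set U, IsCompact K₀ → ∃ V ∈ 𝓝 ξ, ∃ L : ℝ,
      ∀ x ∈ V, ∀ z ∈ V, ∀ μ ∈ K₀, ‖f x μ - f z μ‖ ≤ L * ‖x - z‖)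
    {ρ η : ℝ} (hρ : 0 < ρ) (hη : 0 < η) {W : Set (EuclideanSpace ℝ (Fin n))}
    {K : Set (EuclideanSpace ℝ (Fin n))} (hK : IsCompact K)
    (hconv : ∀ ξ ∈ K, ∃ y, IsSolOn X f (fun _ => ubar) y (Ici 0) ∧ y 0 = ξ ∧
      Tendsto y atTop (𝓝 xbar))
    (hstay : ∀ ξ ∈ K, ∃ y, IsSolOn X f (fun _ => ubar) y (Ici 0) ∧ y 0 = ξ ∧
      ∀ t ≥ (0:ℝ), ball (y t) η ⊆ W) :
    ∃ C : Set (EuclideanSpace ℝ (Fin n)), IsCompact C ∧ C ⊆ X ∧ ∃ Tm ≥ (1:ℝ), ∃ δ > 0, ∀ x H v,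
      CicsTrack f ubar C δ x H v → x 0 ∈ K → ∃ T, 1 ≤ T ∧ T ≤ Tm ∧
        (∀ t ∈ Icc 0 T, x t ∈ C ∧ x t ∈ W) ∧ dist (x T) xbar ≤ ρ := by
  refine hK.induction_on (p := fun K => ∃ C : Set (EuclideanSpace ℝ (Fin n)),
      IsCompact C ∧ C ⊆ X ∧ ∃ Tm ≥ (1:ℝ), ∃ δ > 0, ∀ x H v,
      CicsTrack f ubar C δ x H v → x 0 ∈ K → ∃ T, 1 ≤ T ∧ T ≤ Tm ∧
        (∀ t ∈ Icc 0 T, x t ∈ C ∧ x t ∈ W) ∧ dist (x T) xbar ≤ ρ) ?_ ?_ ?_ ?_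
  · exact ⟨∅, isCompact_empty, empty_subset _, 1, le_rfl, 1, one_pos,
      fun x H v _ h => absurd h (notMem_empty _)⟩
  · rintro s t hst ⟨C, hC, hCX, Tm, hTm, δ, hδ, h⟩
    exact ⟨C, hC, hCX, Tm, hTm, δ, hδ, fun x H v hx h0 => h x H v hx (hst h0)⟩
  · rintro s t ⟨C, hC, hCX, Tm, hTm, δ, hδ, h⟩ ⟨C', hC', hCX', Tm', hTm', δ', hδ', h'⟩
    refine ⟨C ∪ C', hC.union hC', union_subset hCX hCX', max Tm Tm', le_max_of_le_left hTm,
      min δ δ', lt_min hδ hδ', ?_⟩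
    rintro x H v hx (h0 | h0)
    · obtain ⟨T, h1, h2, h3, h4⟩ := h x H v (hx.mono subset_union_left (min_le_left _ _)) h0
      exact ⟨T, h1, h2.trans (le_max_left _ _), fun t ht => ⟨Or.inl (h3 t ht).1, (h3 t ht).2⟩, h4⟩
    · obtain ⟨T, h1, h2, h3, h4⟩ := h' x H v (hx.mono subset_union_right (min_le_right _ _)) h0
      exact ⟨T, h1, h2.trans (le_max_right _ _), fun t ht => ⟨Or.inr (h3 t ht).1, (h3 t ht).2⟩, h4⟩
  · intro ξ hξ
    obtain ⟨y, ⟨hyc, hyX, hyi, hye⟩, hy0, hylim⟩ := hconv ξ hξ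
    obtain ⟨z, ⟨hzc, hzX, hzi, hze⟩, hz0, hzW⟩ := hstay ξ hξ
    obtain ⟨T, hT1, hT⟩ : ∃ T, 1 ≤ T ∧ dist (y T) xbar < ρ / 2 :=
      ((eventually_ge_atTop 1).and (Metric.tendsto_nhds.1 hylim (ρ / 2) (by positivity))).exists
    have hT0 : 0 ≤ T := zero_le_one.trans hT1
    obtain ⟨N, hN, hNX, r, hr, δ, hδ, h⟩ := cics_track hX hfc hflip ubar hyc hyX hyi hye hT0
      (half_pos hρ)
    obtain ⟨N', hN', hNX', r', hr', δ', hδ', h'⟩ := cics_track hX hfc hflip ubar hzc hzX hzi hze hT0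
      hη
    refine ⟨closedBall ξ (min r r'), mem_nhdsWithin_of_mem_nhds
      (closedBall_mem_nhds ξ (lt_min hr hr')), N ∪ N', hN.union hN', union_subset hNX hNX', T, hT1,
      min δ δ', lt_min hδ hδ', fun x H v hx h0 => ⟨T, hT1, le_rfl, fun t ht => ?_, ?_⟩⟩
    · obtain ⟨h1, h2⟩ := h' x H v (hx.mono subset_union_right (min_le_right _ _))
        (by rw [hz0]; exact (mem_closedBall.1 h0).trans (min_le_right _ _)) t ht
      exact ⟨Or.inr h1, hzW t ht.1 h2⟩
    · obtain ⟨-, h2⟩ := h x H v (hx.mono subset_union_left (min_le_left _ _))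
        (by rw [hy0]; exact (mem_closedBall.1 h0).trans (min_le_left _ _)) T ⟨hT0, le_rfl⟩
      linarith [dist_triangle (x T) (y T) xbar]

/-- **Proposition 2.4.** For each compact `K ⊆ O` and each `ε > 0` there exist
`T₀ ≥ 0` and `δ > 0` such that for every input `u` with `‖u‖ < δ` and every
`ξ ∈ K`, the solution `φ(t, ξ, u)` is defined for all `t ≥ 0` and satisfies
`|φ(t, ξ, u)| ≤ ε` for all `t ≥ T₀`. -/
theorem cics_uniform_practical_stability {n : ℕ} {U : Type*} [MetricSpace U]
    (X : Set (EuclideanSpace ℝ (Fin n)))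
    (f : EuclideanSpace ℝ (Fin n) → U → EuclideanSpace ℝ (Fin n))
    (xbar : EuclideanSpace ℝ (Fin n)) (ubar : U)
    (O : Set (EuclideanSpace ℝ (Fin n)))
    -- the state space is open, contains the equilibrium, and `f(x̄, ū) = 0`
    (hX : IsOpen X) (hxbar : xbar ∈ X) (heq : f xbar ubar = 0)
    -- `f` is continuous, and locally Lipschitz in `x` uniformly on compacts of `U`
    (hfc : ContinuousOn (fun p : EuclideanSpace ℝ (Fin n) × U => f p.1 p.2)
      (X ×ˢ (univ : Set U)))
    (hflip : ∀ ξ ∈ X, ∀ K₀ : Set U, IsCompact K₀ → ∃ V ∈ 𝓝 ξ, ∃ L : ℝ,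
      ∀ x ∈ V, ∀ z ∈ V, ∀ μ ∈ K₀, ‖f x μ - f z μ‖ ≤ L * ‖x - z‖)
    -- `x̄` is a stable equilibrium of `ẋ = f(x, ū)` ...
    (hstab : ∀ ε > 0, ∃ δ > 0, ∀ ξ ∈ X, dist ξ xbar ≤ δ →
      ∃ y, IsSolOn X f (fun _ => ubar) y (Ici 0) ∧ y 0 = ξ ∧
        ∀ t ≥ (0:ℝ), dist (y t) xbar < ε)
    -- ... whose domain of attraction is `O`, a neighborhood of `x̄`
    (hO : O = {ξ | ∃ y, IsSolOn X f (fun _ => ubar) y (Ici 0) ∧ y 0 = ξ ∧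
      Tendsto y atTop (𝓝 xbar)})
    (hOnhd : O ∈ 𝓝 xbar) :
    ∀ K : Set (EuclideanSpace ℝ (Fin n)), IsCompact K → K ⊆ O →
    ∀ ε > (0:ℝ), ∃ T₀ ≥ (0:ℝ), ∃ δ > (0:ℝ),
      ∀ u : ℝ → U, IsInput u → SupNormLt u ubar δ →
        ∀ ξ ∈ K, ∃ y, IsSolOn X f u y (Ici 0) ∧ y 0 = ξ ∧
          ∀ t ≥ T₀, dist (y t) xbar ≤ ε := by
  intro K hK hKO ε hε
  obtain ⟨ρ₁, hρ₁, hstab₁⟩ := hstab (ε / 2) (by positivity)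
  obtain ⟨ρ₂, hρ₂, hρ₂O⟩ := Metric.nhds_basis_closedBall.mem_iff.1 hOnhd
  obtain ⟨ρ₃, hρ₃, hρ₃X⟩ := Metric.nhds_basis_closedBall.mem_iff.1 (hX.mem_nhds hxbar)
  obtain ⟨ρ, hρ, h1, h2, h3⟩ : ∃ ρ > 0, ρ ≤ ρ₁ ∧ ρ ≤ ρ₂ ∧ ρ ≤ ρ₃ :=
    ⟨min ρ₁ (min ρ₂ ρ₃), lt_min hρ₁ (lt_min hρ₂ hρ₃), min_le_left _ _,
      (min_le_right _ _).trans (min_le_left _ _), (min_le_right _ _).trans (min_le_right _ _)⟩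
  have hconv : ∀ ξ ∈ O, ∃ y, IsSolOn X f (fun _ => ubar) y (Ici 0) ∧ y 0 = ξ ∧
      Tendsto y atTop (𝓝 xbar) := by
    intro ξ hξ
    rw [hO] at hξ
    exact hξ
  obtain ⟨C₁, hC₁, hCX₁, T₁, hT₁, δ₁, hδ₁, hK₁⟩ := cics_local_unif (W := univ) (η := 1)
    hX hfc hflip hρ one_pos hK (fun ξ hξ => hconv ξ (hKO hξ))
    (fun ξ hξ => by
      obtain ⟨y, hy, hy0, -⟩ := hconv ξ (hKO hξ)
      exact ⟨y, hy, hy0, fun t _ => subset_univ _⟩)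
  obtain ⟨C₂, hC₂, hCX₂, T₂, hT₂, δ₂, hδ₂, hK₂⟩ := cics_local_unif (W := closedBall xbar ε)
    (η := ε / 2) (K := closedBall xbar ρ) hX hfc hflip hρ (half_pos hε) (isCompact_closedBall _ _)
    (fun ξ hξ => hconv ξ (hρ₂O (closedBall_subset_closedBall h2 hξ)))
    (fun ξ hξ => by
      obtain ⟨y, hy, hy0, hyε⟩ := hstab₁ ξ (hρ₃X (closedBall_subset_closedBall h3 hξ))
        ((mem_closedBall.1 hξ).trans h1)
      refine ⟨y, hy, hy0, fun t ht z hz => ?_⟩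
      have a1 := hyε t ht
      have a2 := mem_ball.1 hz
      rw [mem_closedBall]
      linarith [dist_triangle z (y t) xbar])
  refine ⟨T₁, zero_le_one.trans hT₁, min δ₁ δ₂, lt_min hδ₁ hδ₂, ?_⟩
  rintro u hu ⟨b, hb, hub⟩ ξ hξ
  obtain ⟨x, H, hxc, hx0, hxi, hxe, hxd⟩ := cics_exist hX hfc hflip (hC₁.union hC₂)
    (union_subset hCX₁ hCX₂) hu ξ
  rw [ae_restrict_iff' measurableSet_Ici] at hub
  have htr : CicsTrack f ubar (C₁ ∪ C₂) (min δ₁ δ₂) x H u :=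
    ⟨hxc.continuousOn, fun t _ => hxi 0 t, fun t _ => hxe t, hxd,
      hub.mono fun s hs h0 => (hs h0).trans_lt hb⟩
  have key : ∀ k : ℕ, ∃ s : ℝ, (k : ℝ) ≤ s ∧ 0 ≤ s ∧ x s ∈ closedBall xbar ρ ∧
      ∀ t ∈ Icc 0 s, x t ∈ C₁ ∪ C₂ ∧ (T₁ ≤ t → dist (x t) xbar ≤ ε) := by
    intro k
    induction k with
    | zero =>
      obtain ⟨T, hT1, hTm, hin, hend⟩ := hK₁ x H u
        (htr.mono subset_union_left (min_le_left _ _)) (by rw [hx0]; exact hξ)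
      have hT0 : 0 ≤ T := zero_le_one.trans hT1
      refine ⟨T, by simpa using hT0, hT0, hend, fun t ht => ⟨Or.inl (hin t ht).1, fun hle => ?_⟩⟩
      -- here `t = T`, and the endpoint lies in the small ball
      have : t = T := le_antisymm ht.2 (hTm.trans hle)
      obtain ⟨_, _, _, hin', _⟩ := hK₂ _ _ _
        ((htr.shift hT0).mono subset_union_right (min_le_right _ _)) (by simpa using hend)
      have := (hin' 0 ⟨le_rfl, by linarith⟩).2
      simp only [add_zero] at this
      subst t
      exact this
    | succ k ih =>
      obtain ⟨s, hks, hs0, hsB, hs⟩ := ih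
      obtain ⟨T, hT1, hTm, hin, hend⟩ := hK₂ _ _ _
        ((htr.shift hs0).mono subset_union_right (min_le_right _ _)) (by simpa using hsB)
      refine ⟨s + T, by push_cast; linarith, by linarith, hend, fun t ht => ?_⟩
      rcases le_total t s with hts | hts
      · exact hs t ⟨ht.1, hts⟩
      · have := hin (t - s) ⟨by linarith, by linarith [ht.2]⟩
        simp only [add_sub_cancel] at this
        exact ⟨Or.inr this.1, fun _ => this.2⟩
  have hall : ∀ t ≥ 0, x t ∈ C₁ ∪ C₂ ∧ (T₁ ≤ t → dist (x t) xbar ≤ ε) := by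
    intro t ht
    obtain ⟨k, hk⟩ := exists_nat_ge t
    obtain ⟨s, hks, -, -, hs⟩ := key k
    exact hs t ⟨ht, hk.trans hks⟩
  have hH : ∀ s > 0, H s = f (x s) (u s) := fun s hs => hxd s hs (hall s hs.le).1
  refine ⟨x, ⟨hxc.continuousOn, fun t ht => union_subset hCX₁ hCX₂ (hall t ht).1, fun t ht => ?_,
    fun t ht => ?_⟩, hx0, fun t ht => (hall t ((zero_le_one.trans hT₁).trans ht)).2 ht⟩
  · refine (hxi 0 t).congr fun s hs => ?_
    rw [uIoc_of_le ht] at hs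
    exact hH s hs.1
  · rw [hxe t]
    congr 1
    refine intervalIntegral.integral_congr_ae (Eventually.of_forall fun s hs => ?_)
    rw [uIoc_of_le ht] at hs
    exact hH s hs.1
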